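/- Let A = KQ/I where Q is a finite quiver with exactly one vertex and I is an admissible ideal of KQ (equivalently, A is a finite-dimensional local basic algebra over K). Then the following are equivalent: (i) A is geometrically irreducible; (ii) Q has at most one arrow; (iii) A is isomorphic as a K-algebra to K[X]/(X^m) for some m ≥ 1. -/

import Mathlib

open scoped BigOperators

noncomputable section
/-! ## Quivers and paths -/

/-- A finite quiver: finite sets of vertices and arrows together with source and
target maps. -/
structure FinQuiver : Type 1 where
  V : Type
  A : Type
  [fintypeV : Fintype V]
  [fintypeA : Fintype A]
  [decEqV : DecidableEq V]
  [decEqA : DecidableEq A]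
  src : A → V
  tgt : A → V

attribute [instance] FinQuiver.fintypeV FinQuiver.fintypeA FinQuiver.decEqV FinQuiver.decEqA

/-- A path of positive length in a quiver: a list of composable arrows `[a₁, …, aₘ]`
satisfying `s (aᵢ) = t (aᵢ₊₁)`. -/
structure QPath (Q : FinQuiver) : Type where
  arrows : List Q.A
  ne : arrows ≠ []
  chain : arrows.Chain' fun a b => Q.src a = Q.tgt b

namespace QPath

variable {Q : FinQuiver}

/-- The length of a path. -/
def length (p : QPath Q) : ℕ := p.arrows.length

/-- The target `t (a₁)` of a path `(a₁, …, aₘ)`. -/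
def tgt (p : QPath Q) : Q.V := Q.tgt (p.arrows.head p.ne)

/-- The source `s (aₘ)` of a path `(a₁, …, aₘ)`. -/
def src (p : QPath Q) : Q.V := Q.src (p.arrows.getLast p.ne)

/-- A path is a cycle if its source equals its target. -/
def IsCycle (p : QPath Q) : Prop := p.src = p.tgt

/-- A cycle `(a₁, …, aₘ)` is primitive if the vertices `s (a₁), …, s (aₘ)` are pairwise
different. -/
def IsPrimitive (p : QPath Q) : Prop := (p.arrows.map Q.src).Nodup

end QPath

/-! ## The path algebra, relations, admissible ideals and representation varieties -/

/-- The defining relations presenting the path algebra `KQ` as a quotient of the free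
algebra on the vertices and arrows of `Q`: the vertices become a complete set of
orthogonal idempotents summing to `1`, and `e_{t(a)} * a = a = a * e_{s(a)}` for every
arrow `a`. -/
inductive PathRel (K : Type) [Field K] (Q : FinQuiver) :
    FreeAlgebra K (Q.V ⊕ Q.A) → FreeAlgebra K (Q.V ⊕ Q.A) → Prop
  | idem (i : Q.V) : PathRel K Q
      (FreeAlgebra.ι K (Sum.inl i) * FreeAlgebra.ι K (Sum.inl i)) (FreeAlgebra.ι K (Sum.inl i))
  | orth (i j : Q.V) (h : i ≠ j) : PathRel K Q
      (FreeAlgebra.ι K (Sum.inl i) * FreeAlgebra.ι K (Sum.inl j)) 0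
  | sum_one : PathRel K Q (∑ i : Q.V, FreeAlgebra.ι K (Sum.inl i)) 1
  | tgt_mul (a : Q.A) : PathRel K Q
      (FreeAlgebra.ι K (Sum.inl (Q.tgt a)) * FreeAlgebra.ι K (Sum.inr a))
      (FreeAlgebra.ι K (Sum.inr a))
  | mul_src (a : Q.A) : PathRel K Q
      (FreeAlgebra.ι K (Sum.inr a) * FreeAlgebra.ι K (Sum.inl (Q.src a)))
      (FreeAlgebra.ι K (Sum.inr a))

/-- The path algebra `KQ`. -/
abbrev PathAlgebra (K : Type) [Field K] (Q : FinQuiver) : Type := RingQuot (PathRel K Q)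

variable (K : Type) [Field K] (Q : FinQuiver)

/-- The idempotent `eᵢ ∈ KQ` corresponding to a vertex `i` (the path of length zero
at `i`). -/
def vertexElem (i : Q.V) : PathAlgebra K Q :=
  RingQuot.mkAlgHom K (PathRel K Q) (FreeAlgebra.ι K (Sum.inl i))

/-- The element of `KQ` corresponding to an arrow `a`. -/
def arrowElem (a : Q.A) : PathAlgebra K Q :=
  RingQuot.mkAlgHom K (PathRel K Q) (FreeAlgebra.ι K (Sum.inr a))

/-- The element of `KQ` corresponding to a path `(a₁, …, aₘ)`, namely `a₁ ⋯ aₘ`. -/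
def pathElem (p : QPath Q) : PathAlgebra K Q := (p.arrows.map (arrowElem K Q)).prod

/-- The element `∑ₚ c p • p` of `KQ` determined by a finitely supported family of
coefficients on paths. -/
def relElem (c : QPath Q →₀ K) : PathAlgebra K Q := c.sum fun p l => l • pathElem K Q p

/-- `c` is the datum of a relation with common target `i` and common source `j`: all
paths in its support have length at least two, target `i` and source `j`.  (The paths in
the support are pairwise different and have nonzero coefficients by definition of a
finitely supported function.) -/
def IsRelationData (c : QPath Q →₀ K) (i j : Q.V) : Prop :=
  ∀ p ∈ c.support, 2 ≤ p.length ∧ p.tgt = i ∧ p.src = j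

/-- An element of `KQ` is a relation if it is a `K`-linear combination `∑ λₚ • p` of
pairwise different paths of length at least two having a common source and a common
target, with all `λₚ ≠ 0`. -/
def IsRelation (x : PathAlgebra K Q) : Prop :=
  ∃ (c : QPath Q →₀ K) (i j : Q.V), IsRelationData K Q c i j ∧ x = relElem K Q c

/-- The two-sided ideal generated by a set `S`, as a set: the additive subgroup generated
by all elements `a * s * b` with `s ∈ S`. -/
def twoSidedSpan (R : Type) [Ring R] (S : Set R) : Set R :=
  (AddSubgroup.closure {x | ∃ a b : R, ∃ s ∈ S, x = a * s * b} : AddSubgroup R)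

/-- `φ : KQ →ₐ[K] A` presents `A` as `KQ/I` with `I = ker φ` an admissible ideal:
`φ` is surjective, its kernel is generated (as a two-sided ideal) by a set of relations,
and there is some `m ≥ 2` such that all paths of length at least `m` lie in the kernel. -/
def IsAdmissiblePresentation {A : Type} [Ring A] [Algebra K A]
    (φ : PathAlgebra K Q →ₐ[K] A) : Prop :=
  Function.Surjective φ ∧
  (∃ S : Set (PathAlgebra K Q), (∀ x ∈ S, IsRelation K Q x) ∧
    twoSidedSpan (PathAlgebra K Q) S = {x | φ x = 0}) ∧
  ∃ m : ℕ, 2 ≤ m ∧ ∀ p : QPath Q, m ≤ p.length → φ (pathElem K Q p) = 0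

/-- The index type for the rows/columns of the matrices in a `d`-dimensional
representation: the basis vectors of `⊕ᵢ K^{dᵢ}`. -/
abbrev RepIx (d : Q.V → ℕ) : Type := (i : Q.V) × Fin (d i)

/-- The ambient affine space of `d`-dimensional representations.  An arrow `a` gets a
matrix; membership in `RepSet` forces the matrix of `a` to be concentrated in the block
with rows indexed by the block `t(a)` and columns indexed by the block `s(a)`, i.e. to be
(the block extension of) a `d (t a) × d (s a)`-matrix. -/
abbrev RepSpace (d : Q.V → ℕ) : Type := Q.A → Matrix (RepIx Q d) (RepIx Q d) K

/-- The Zariski topology on affine space `K^ι`: generated by the complements of zero sets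
of polynomials in the coordinates. -/
def zariskiTopology (ι R : Type) [CommSemiring R] : TopologicalSpace (ι → R) :=
  TopologicalSpace.generateFrom
    {U | ∃ f : MvPolynomial ι R, U = {x | MvPolynomial.eval x f ≠ 0}}

/-- The Zariski topology on the ambient space of `d`-dimensional representations. -/
def repTopology (d : Q.V → ℕ) : TopologicalSpace (RepSpace K Q d) :=
  TopologicalSpace.induced (fun M (x : Q.A × RepIx Q d × RepIx Q d) => M x.1 x.2.1 x.2.2)
    (zariskiTopology (Q.A × RepIx Q d × RepIx Q d) K)

/-- The condition that the matrix of each arrow `a` is concentrated in the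
`(t a, s a)`-block, i.e. really is a `d (t a) × d (s a)`-matrix. -/
def BlockCompatible (d : Q.V → ℕ) (M : RepSpace K Q d) : Prop :=
  ∀ (a : Q.A) (u v : RepIx Q d), M a u v ≠ 0 → u.1 = Q.tgt a ∧ v.1 = Q.src a

/-- The evaluation `M(p) = M(a₁) ⋯ M(aₘ)` of a representation at a path. -/
def pathProd (d : Q.V → ℕ) (M : RepSpace K Q d) (p : QPath Q) :
    Matrix (RepIx Q d) (RepIx Q d) K := (p.arrows.map M).prod

/-- The evaluation `M(ρ) = ∑ λₚ M(p)` of a representation at a linear combination of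
paths. -/
def relEval (d : Q.V → ℕ) (M : RepSpace K Q d) (c : QPath Q →₀ K) :
    Matrix (RepIx Q d) (RepIx Q d) K := c.sum fun p l => l • pathProd K Q d M p

/-- The affine variety `rep(A, d)` of `d`-dimensional representations of `A = KQ/I`,
where `I = ker φ`: tuples of matrices (of the correct block sizes) with `M(ρ) = 0` for
every relation `ρ ∈ I`. -/
def RepSet {A : Type} [Ring A] [Algebra K A] (φ : PathAlgebra K Q →ₐ[K] A) (d : Q.V → ℕ) :
    Set (RepSpace K Q d) :=
  {M | BlockCompatible K Q d M ∧
    ∀ (c : QPath Q →₀ K) (i j : Q.V), IsRelationData K Q c i j →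
      φ (relElem K Q c) = 0 → relEval K Q d M c = 0}

/-- `A = KQ/I` (presented by `φ`, with `I = ker φ`) is geometrically irreducible if
`rep(A, d)` is an irreducible topological space for every dimension vector `d`. -/
def IsGeomIrreducible {A : Type} [Ring A] [Algebra K A] (φ : PathAlgebra K Q →ₐ[K] A) :
    Prop :=
  ∀ d : Q.V → ℕ, @IsIrreducible _ (repTopology K Q d) (RepSet K Q φ d)

/-! ## Flags adapted to a nilpotent endomorphism -/

section NilpotentFlag

variable {F V : Type} [Field F] [AddCommGroup V] [Module F V]

lemma map_range_pow (f : Module.End F V) (k : ℕ) :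
    (LinearMap.range (f ^ k)).map f = LinearMap.range (f ^ (k + 1)) := by
  rw [pow_succ', Module.End.mul_eq_comp, LinearMap.range_comp]

lemma range_pow_le_range_pow (f : Module.End F V) {i m : ℕ} (him : i ≤ m) :
    LinearMap.range (f ^ m) ≤ LinearMap.range (f ^ i) := by
  obtain ⟨k, rfl⟩ := Nat.exists_eq_add_of_le him
  rw [pow_add, Module.End.mul_eq_comp]
  exact LinearMap.range_comp_le_range _ _

variable [FiniteDimensional F V]

lemma finrank_map_add_finrank_inf_ker (f : Module.End F V) (P : Submodule F V) :
    Module.finrank F (P.map f) + Module.finrank F (P ⊓ LinearMap.ker f : Submodule F V) =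
      Module.finrank F P := by
  have h := LinearMap.finrank_range_add_finrank_ker (f.domRestrict P)
  rw [LinearMap.range_domRestrict, LinearMap.ker_domRestrict] at h
  rw [← h, (Submodule.equivSubtypeMap P _).finrank_eq, Submodule.map_comap_subtype]

lemma finrank_le_range_pow_add (f : Module.End F V) (k : ℕ) :
    Module.finrank F V ≤ Module.finrank F (LinearMap.range (f ^ k)) +
      k * Module.finrank F (LinearMap.ker f) := by
  induction k with
  | zero => rw [pow_zero, Module.End.one_eq_id, LinearMap.range_id, finrank_top, zero_mul, add_zero]
  | succ k ih =>
    have h := finrank_map_add_finrank_inf_ker f (LinearMap.range (f ^ k))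
    rw [map_range_pow] at h
    have h2 : Module.finrank F (LinearMap.range (f ^ k) ⊓ LinearMap.ker f : Submodule F V) ≤
        Module.finrank F (LinearMap.ker f) := Submodule.finrank_mono inf_le_right
    rw [add_mul]
    omega

lemma finrank_range_pow_add_mul_le (f : Module.End F V) (m : ℕ) (hf : f ^ (m + 1) = 0) (k : ℕ)
    (hk : k ≤ m + 1) :
    Module.finrank F (LinearMap.range (f ^ k)) + k * Module.finrank F (LinearMap.range (f ^ m)) ≤
      Module.finrank F V := by
  induction k with
  | zero => rw [pow_zero, Module.End.one_eq_id, LinearMap.range_id, finrank_top, zero_mul, add_zero]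
  | succ k ih =>
    have h := finrank_map_add_finrank_inf_ker f (LinearMap.range (f ^ k))
    rw [map_range_pow] at h
    have hker : LinearMap.range (f ^ m) ≤ LinearMap.ker f := by
      rintro _ ⟨x, rfl⟩
      rw [LinearMap.mem_ker, ← Module.End.mul_apply, ← pow_succ', hf, LinearMap.zero_apply]
    have h2 : Module.finrank F (LinearMap.range (f ^ m)) ≤
        Module.finrank F (LinearMap.range (f ^ k) ⊓ LinearMap.ker f : Submodule F V) :=
      Submodule.finrank_mono (le_inf (range_pow_le_range_pow f (by omega)) hker)
    have h3 := ih (by omega)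
    rw [add_mul]
    omega

lemma exists_submodule_between (P R : Submodule F V) (hPR : P ≤ R) (n : ℕ)
    (hP : Module.finrank F P ≤ n) (hR : n ≤ Module.finrank F R) :
    ∃ S : Submodule F V, P ≤ S ∧ S ≤ R ∧ Module.finrank F S = n := by
  induction n, hP using Nat.le_induction with
  | base => exact ⟨P, le_rfl, hPR, rfl⟩
  | succ n hn ih =>
    obtain ⟨S, hPS, hSR, hS⟩ := ih (by omega)
    have hlt : S < R := lt_of_le_of_ne hSR (by rintro rfl; omega)
    obtain ⟨x, hxR, hxS⟩ := SetLike.exists_of_lt hlt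
    refine ⟨S ⊔ F ∙ x, hPS.trans le_sup_left,
      sup_le hSR ((Submodule.span_singleton_le_iff_mem _ _).2 hxR), ?_⟩
    have hx : x ≠ 0 := by rintro rfl; exact hxS S.zero_mem
    have hdisj : S ⊓ F ∙ x = ⊥ :=
      disjoint_iff.1 (Submodule.disjoint_span_singleton_of_notMem hxS)
    have h := Submodule.finrank_sup_add_finrank_inf_eq S (F ∙ x)
    rw [hdisj, finrank_bot, finrank_span_singleton hx, hS] at h
    omega

lemma exists_range_le_le_ker_pow (f : Module.End F V) (m : ℕ) (hf : f ^ (m + 1) = 0) :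
    ∃ S : Submodule F V, LinearMap.range f ≤ S ∧ S ≤ LinearMap.ker (f ^ m) ∧
      Module.finrank F S = Module.finrank F V - (Module.finrank F V + m) / (m + 1) := by
  have hle : LinearMap.range f ≤ LinearMap.ker (f ^ m) := by
    rintro _ ⟨x, rfl⟩
    rw [LinearMap.mem_ker, ← Module.End.mul_apply, ← pow_succ, hf, LinearMap.zero_apply]
  have h1 := finrank_le_range_pow_add f (m + 1)
  have h2 := finrank_range_pow_add_mul_le f m hf (m + 1) le_rfl
  rw [hf, LinearMap.range_zero, finrank_bot, zero_add] at h1 h2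
  have h3 := LinearMap.finrank_range_add_finrank_ker f
  have h4 := LinearMap.finrank_range_add_finrank_ker (f ^ m)
  set d := Module.finrank F V
  have h5 : (d + m) / (m + 1) ≤ Module.finrank F (LinearMap.ker f) := by
    rw [← Nat.lt_succ_iff, Nat.div_lt_iff_lt_mul (Nat.succ_pos m)]
    nlinarith
  have h6 : Module.finrank F (LinearMap.range (f ^ m)) ≤ (d + m) / (m + 1) := by
    rw [Nat.le_div_iff_mul_le (Nat.succ_pos m)]
    nlinarith
  exact exists_submodule_between _ _ hle _ (by omega) (by omega)

end NilpotentFlag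

/-- There is a height function, depending only on `m` and `d`, such that every endomorphism `f` of
a `d`-dimensional space with `f ^ (m + 1) = 0` has a basis in which it strictly decreases
heights. -/
lemma exists_height_basis (F : Type) [Field F] (m : ℕ) : ∀ d : ℕ,
    ∃ (ι : Type) (_ : Fintype ι) (h : ι → ℕ), Fintype.card ι = d ∧ (∀ i, h i ≤ m) ∧
      ∀ (V : Type) [AddCommGroup V] [Module F V] [FiniteDimensional F V],
        Module.finrank F V = d → ∀ f : Module.End F V, f ^ (m + 1) = 0 →
          ∃ b : Module.Basis ι F V, ∀ i j, b.repr (f (b j)) i ≠ 0 → h i < h j := by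
  induction m with
  | zero =>
    intro d
    refine ⟨Fin d, inferInstance, fun _ => 0, by simp, fun i => le_rfl, ?_⟩
    intro V _ _ _ hV f hf
    refine ⟨Module.finBasisOfFinrankEq F V hV, fun i j hij => absurd ?_ hij⟩
    rw [zero_add, pow_one] at hf
    simp [hf]
  | succ m ih =>
    intro d
    set c := (d + (m + 1)) / (m + 1 + 1) with hc
    have hcd : c ≤ d := by
      rw [← Nat.lt_succ_iff, Nat.div_lt_iff_lt_mul (Nat.succ_pos _)]
      nlinarith
    obtain ⟨ι, _, h, hcard, hm, hV⟩ := ih (d - c)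
    refine ⟨ι ⊕ Fin c, inferInstance, Sum.elim h fun _ => m + 1, ?_, ?_, ?_⟩
    · rw [Fintype.card_sum, hcard, Fintype.card_fin]
      omega
    · rintro (i | i)
      · exact (hm i).trans (Nat.le_succ m)
      · exact le_rfl
    intro V _ _ _ hVd f hf
    obtain ⟨S, hfS, hS, hSd⟩ := exists_range_le_le_ker_pow f (m + 1) hf
    rw [hVd, ← hc] at hSd
    obtain ⟨C, hSC⟩ := Submodule.exists_isCompl S
    have hCd : Module.finrank F C = c := by
      have := Submodule.finrank_add_eq_of_isCompl hSC
      omega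
    have hmem : ∀ x, f x ∈ S := fun x => hfS ⟨x, rfl⟩
    have hfres : (f.restrict fun x _ => hmem x : Module.End F S) ^ (m + 1) = 0 := by
      ext x
      rw [Module.End.pow_restrict]
      exact hS x.2
    obtain ⟨b, hb⟩ := hV S hSd _ hfres
    set e := Submodule.prodEquivOfIsCompl S C hSC
    have hsymm : ∀ x (hx : x ∈ S), e.symm x = (⟨x, hx⟩, 0) := by
      intro x hx
      rw [LinearEquiv.symm_apply_eq]
      simp [e]
    have hinl : ∀ x (hx : x ∈ S) i, ((b.prod (Module.finBasisOfFinrankEq F C hCd)).map e).repr x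
        (Sum.inl i) = b.repr ⟨x, hx⟩ i := by
      intro x hx i
      simp [hsymm x hx]
    have hinr : ∀ x (_ : x ∈ S) i, ((b.prod (Module.finBasisOfFinrankEq F C hCd)).map e).repr x
        (Sum.inr i) = 0 := by
      intro x hx i
      simp [hsymm x hx]
    refine ⟨(b.prod (Module.finBasisOfFinrankEq F C hCd)).map e, ?_⟩
    rintro (i | i) (j | j) hij
    · rw [hinl _ (hmem _)] at hij
      refine hb i j ?_
      convert hij
      simp [e]
    · exact Nat.lt_succ_of_le (hm i)
    · exact absurd (hinr _ (hmem _) _) hij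
    · exact absurd (hinr _ (hmem _) _) hij

/-! ## Nilpotent matrices of bounded index as an image of affine space -/

section NilpotentMatrices

variable {F ι : Type} [Field F] [Fintype ι] [DecidableEq ι]

lemma pow_eq_zero_of_height (h : ι → ℕ) (m : ℕ) (hm : ∀ i, h i ≤ m) (t : Matrix ι ι F)
    (ht : ∀ i j, t i j ≠ 0 → h i < h j) : t ^ (m + 1) = 0 := by
  have key : ∀ k i j, (t ^ k) i j ≠ 0 → h i + k ≤ h j := by
    intro k
    induction k with
    | zero =>
      intro i j hij
      rw [pow_zero, Matrix.one_apply] at hij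
      have : i = j := by by_contra hne; simp [hne] at hij
      simp [this]
    | succ k ih =>
      intro i j hij
      rw [pow_succ, Matrix.mul_apply] at hij
      obtain ⟨l, -, hl⟩ := Finset.exists_ne_zero_of_sum_ne_zero hij
      have h1 := ih i l (left_ne_zero_of_mul hl)
      have h2 := ht l j (right_ne_zero_of_mul hl)
      omega
  ext i j
  by_contra hij
  have h1 := key _ i j hij
  have h2 := hm j
  omega

lemma conj_adjugate_pow_eq_zero (g t : Matrix ι ι F) (m : ℕ) (ht : t ^ (m + 1) = 0) :
    (g * t * g.adjugate) ^ (m + 1) = 0 := by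
  have key : ∀ k, (g * t * g.adjugate) ^ (k + 1) = g.det ^ k • (g * t ^ (k + 1) * g.adjugate) := by
    intro k
    induction k with
    | zero => simp
    | succ k ih =>
      rw [pow_succ, ih, smul_mul_assoc, pow_succ g.det, mul_smul]
      congr 1
      rw [show g * t ^ (k + 1) * g.adjugate * (g * t * g.adjugate) =
        g * t ^ (k + 1) * (g.adjugate * g) * t * g.adjugate by simp only [mul_assoc],
        Matrix.adjugate_mul, mul_smul_comm, mul_one, smul_mul_assoc, smul_mul_assoc,
        pow_succ t (k + 1), ← mul_assoc]
  rw [key, ht, mul_zero, zero_mul, smul_zero]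

lemma exists_height_conj (F ι : Type) [Field F] [Fintype ι] [DecidableEq ι] (m : ℕ) :
    ∃ h : ι → ℕ, (∀ i, h i ≤ m) ∧ ∀ X : Matrix ι ι F, X ^ (m + 1) = 0 →
      ∃ g t : Matrix ι ι F, (∀ i j, t i j ≠ 0 → h i < h j) ∧ X = g * t * g.adjugate := by
  obtain ⟨κ, _, h, hcard, hm, hV⟩ := exists_height_basis F m (Fintype.card ι)
  let e : κ ≃ ι := Fintype.equivOfCardEq hcard
  refine ⟨h ∘ e.symm, fun i => hm _, fun X hX => ?_⟩
  obtain ⟨b, hb⟩ := hV (ι → F) (by simp) (Matrix.toLin' X)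
    (by rw [← Matrix.toLin'_pow, hX, map_zero])
  let b' := b.reindex e
  let s := Pi.basisFun F ι
  have hgg : s.toMatrix b' * b'.toMatrix s = 1 := s.toMatrix_mul_toMatrix_flip b'
  have hdet : (s.toMatrix b').det ≠ 0 := fun h0 => by
    have := congrArg Matrix.det hgg
    rw [Matrix.det_mul, h0, zero_mul, Matrix.det_one] at this
    exact zero_ne_one this
  have hadj : (s.toMatrix b').adjugate = (s.toMatrix b').det • b'.toMatrix s := by
    calc (s.toMatrix b').adjugate
        = (s.toMatrix b').adjugate * (s.toMatrix b' * b'.toMatrix s) := by rw [hgg, mul_one]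
      _ = _ := by rw [← mul_assoc, Matrix.adjugate_mul, smul_mul_assoc, one_mul]
  refine ⟨s.toMatrix b', (s.toMatrix b').det⁻¹ • LinearMap.toMatrix b' b' (Matrix.toLin' X), ?_, ?_⟩
  · intro i j hij
    refine hb _ _ (fun h0 => hij ?_)
    rw [Matrix.smul_apply, LinearMap.toMatrix_apply]
    simp only [b', Module.Basis.repr_reindex, Module.Basis.coe_reindex, Function.comp,
      Finsupp.mapDomain_equiv_apply]
    rw [h0, smul_zero]
  · rw [hadj, mul_smul_comm, mul_smul_comm, smul_mul_assoc, smul_smul, mul_inv_cancel₀ hdet,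
      one_smul, basis_toMatrix_mul_linearMap_toMatrix, linearMap_toMatrix_mul_basis_toMatrix,
      ← Matrix.toLin_eq_toLin', LinearMap.toMatrix_toLin]

end NilpotentMatrices

/-! ## Path algebras of quivers with one vertex -/

section OneVertex

variable {K Q}

lemma vertexElem_eq_one (hV : Fintype.card Q.V = 1) (i : Q.V) : vertexElem K Q i = 1 := by
  have h := RingQuot.mkAlgHom_rel K (PathRel.sum_one (K := K) (Q := Q))
  obtain ⟨j, hj⟩ := Fintype.card_eq_one_iff.1 hV
  rw [Fintype.sum_eq_single i (fun k hk => absurd ((hj k).trans (hj i).symm) hk), map_one] at h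
  exact h

lemma pathAlgebra_hom_ext (hV : Fintype.card Q.V = 1) {R : Type} [Ring R] [Algebra K R]
    {f g : PathAlgebra K Q →ₐ[K] R} (h : ∀ a, f (arrowElem K Q a) = g (arrowElem K Q a)) :
    f = g := by
  refine RingQuot.ringQuot_ext' K f g (FreeAlgebra.hom_ext (funext ?_))
  rintro (i | a)
  · change f (vertexElem K Q i) = g (vertexElem K Q i)
    rw [vertexElem_eq_one hV, map_one, map_one]
  · exact h a

lemma adjoin_arrowElem (hV : Fintype.card Q.V = 1) :
    Algebra.adjoin K (Set.range (arrowElem K Q)) = ⊤ := by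
  rw [eq_top_iff, ← (AlgHom.range_eq_top (RingQuot.mkAlgHom K (PathRel K Q))).2
    (RingQuot.mkAlgHom_surjective K _), ← Algebra.map_top, ← FreeAlgebra.adjoin_range_ι,
    AlgHom.map_adjoin, Algebra.adjoin_le_iff]
  rintro _ ⟨_, ⟨i | a, rfl⟩, rfl⟩
  · change vertexElem K Q i ∈ _
    rw [vertexElem_eq_one hV]
    exact one_mem _
  · exact Algebra.subset_adjoin ⟨a, rfl⟩

/-- The algebra homomorphism on the path algebra of a quiver with one vertex which takes
prescribed values on the arrows. -/
def liftArrows (hV : Fintype.card Q.V = 1) {R : Type} [Ring R] [Algebra K R] (F : Q.A → R) :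
    PathAlgebra K Q →ₐ[K] R :=
  RingQuot.liftAlgHom K ⟨FreeAlgebra.lift K (Sum.elim (fun _ => 1) F), by
    intro x y hxy
    cases hxy with
    | idem i => simp
    | orth i j h => exact absurd (Fintype.card_le_one_iff.1 hV.le i j) h
    | sum_one => simp [hV]
    | tgt_mul a => simp
    | mul_src a => simp⟩

@[simp] lemma liftArrows_arrowElem (hV : Fintype.card Q.V = 1) {R : Type} [Ring R] [Algebra K R]
    (F : Q.A → R) (a : Q.A) : liftArrows (K := K) hV F (arrowElem K Q a) = F a := by
  rw [liftArrows, arrowElem, RingQuot.liftAlgHom_mkAlgHom_apply]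
  simp

lemma liftArrows_relElem (hV : Fintype.card Q.V = 1) {R : Type} [Ring R] [Algebra K R]
    (F : Q.A → R) (c : QPath Q →₀ K) :
    liftArrows hV F (relElem K Q c) = c.sum fun p l => l • (p.arrows.map F).prod := by
  rw [relElem, map_finsuppSum]
  refine Finsupp.sum_congr fun p _ => ?_
  rw [map_smul, pathElem, map_list_prod, List.map_map]
  congr 3
  funext a
  exact liftArrows_arrowElem hV F a

variable {A : Type} [Ring A] [Algebra K A] {φ : PathAlgebra K Q →ₐ[K] A}

lemma exists_algHom_factor {P R : Type} [Ring P] [Algebra K P] [Ring R] [Algebra K R]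
    (φ : P →ₐ[K] A) (hφ : Function.Surjective φ) (ψ : P →ₐ[K] R) (h : ∀ x, φ x = 0 → ψ x = 0) :
    ∃ ρ : A →ₐ[K] R, ∀ x, ρ (φ x) = ψ x := by
  have key : ∀ x, ψ (Function.surjInv hφ (φ x)) = ψ x := fun x => by
    rw [← sub_eq_zero, ← map_sub]
    exact h _ (by rw [map_sub, Function.surjInv_eq hφ, sub_self])
  refine ⟨AlgHom.ofLinearMap
    { toFun := fun a => ψ (Function.surjInv hφ a)
      map_add' := fun a b => ?_
      map_smul' := fun r a => ?_ } ?_ fun a b => ?_, key⟩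
  · obtain ⟨x, rfl⟩ := hφ a
    obtain ⟨y, rfl⟩ := hφ b
    rw [← map_add, key, key, key, map_add]
  · obtain ⟨x, rfl⟩ := hφ a
    rw [← map_smul, key, key, map_smul, RingHom.id_apply]
  · change ψ (Function.surjInv hφ 1) = 1
    rw [← map_one φ, key, map_one]
  · change ψ (Function.surjInv hφ (a * b)) =
      ψ (Function.surjInv hφ a) * ψ (Function.surjInv hφ b)
    obtain ⟨x, rfl⟩ := hφ a
    obtain ⟨y, rfl⟩ := hφ b
    rw [← map_mul, key, key, key, map_mul]

/-- A family of elements satisfying the relations defining `A` determines a homomorphism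
from `A`. -/
lemma exists_hom_of_relations (hadm : IsAdmissiblePresentation K Q φ)
    (hV : Fintype.card Q.V = 1) {R : Type} [Ring R] [Algebra K R] (F : Q.A → R)
    (hF : ∀ (c : QPath Q →₀ K) (i j : Q.V), IsRelationData K Q c i j →
      φ (relElem K Q c) = 0 → (c.sum fun p l => l • (p.arrows.map F).prod) = 0) :
    ∃ ρ : A →ₐ[K] R, ∀ a, ρ (φ (arrowElem K Q a)) = F a := by
  obtain ⟨hsurj, ⟨S, hS, hspan⟩, -⟩ := hadm
  have hker : ∀ x, φ x = 0 → liftArrows hV F x = 0 := by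
    intro x hx
    have hx' : x ∈ twoSidedSpan (PathAlgebra K Q) S := by rw [hspan]; exact hx
    refine AddSubgroup.closure_induction (p := fun y _ => liftArrows hV F y = 0) ?_ (map_zero _)
      ?_ ?_ hx'
    · rintro _ ⟨a, b, s, hs, rfl⟩
      have hs0 : φ s = 0 := by
        have : s ∈ twoSidedSpan (PathAlgebra K Q) S :=
          AddSubgroup.subset_closure ⟨1, 1, s, hs, by simp⟩
        rw [hspan] at this
        exact this
      obtain ⟨c, i, j, hc, rfl⟩ := hS s hs
      rw [map_mul, map_mul, liftArrows_relElem, hF c i j hc hs0, mul_zero, zero_mul]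
    · intro y z _ _ hy hz
      rw [map_add, hy, hz, add_zero]
    · intro y _ hy
      rw [map_neg, hy, neg_zero]
  obtain ⟨ρ, hρ⟩ := exists_algHom_factor φ hsurj _ hker
  exact ⟨ρ, fun a => by rw [hρ, liftArrows_arrowElem]⟩

lemma mem_repSet_iff (hadm : IsAdmissiblePresentation K Q φ) (hV : Fintype.card Q.V = 1)
    (d : Q.V → ℕ) (M : RepSpace K Q d) :
    M ∈ RepSet K Q φ d ↔ ∃ ρ : A →ₐ[K] Matrix (RepIx Q d) (RepIx Q d) K,
      ∀ a, M a = ρ (φ (arrowElem K Q a)) := by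
  constructor
  · rintro ⟨-, hM⟩
    obtain ⟨ρ, hρ⟩ := exists_hom_of_relations hadm hV M hM
    exact ⟨ρ, fun a => (hρ a).symm⟩
  · rintro ⟨ρ, hρ⟩
    refine ⟨fun a u v _ => ⟨Fintype.card_le_one_iff.1 hV.le _ _,
      Fintype.card_le_one_iff.1 hV.le _ _⟩, fun c i j _ h0 => ?_⟩
    have hlift : ρ.comp φ = liftArrows hV M :=
      pathAlgebra_hom_ext hV fun a => by simp [hρ]
    have := liftArrows_relElem hV M c
    rw [← hlift, AlgHom.comp_apply, h0, map_zero] at this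
    exact this.symm

lemma exists_hom_trivSqZeroExt (hadm : IsAdmissiblePresentation K Q φ)
    (hV : Fintype.card Q.V = 1) :
    ∃ θ : A →ₐ[K] TrivSqZeroExt K (Q.A → K),
      ∀ a, θ (φ (arrowElem K Q a)) = TrivSqZeroExt.inr (Pi.single a 1) := by
  refine exists_hom_of_relations hadm hV _ fun c i j hc _ => Finset.sum_eq_zero fun p hp => ?_
  have h2 := (hc p hp).1
  rw [QPath.length] at h2
  rcases hl : p.arrows with _ | ⟨a, _ | ⟨b, l⟩⟩
  · simp [hl] at h2
  · simp [hl] at h2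
  · simp only [hl]
    rw [List.map_cons, List.map_cons, List.prod_cons, List.prod_cons, ← mul_assoc,
      TrivSqZeroExt.inr_mul_inr, zero_mul, smul_zero]

lemma exists_augmentation (hadm : IsAdmissiblePresentation K Q φ) (hV : Fintype.card Q.V = 1) :
    ∃ ε : A →ₐ[K] K, ∀ a, ε (φ (arrowElem K Q a)) = 0 := by
  obtain ⟨θ, hθ⟩ := exists_hom_trivSqZeroExt hadm hV
  exact ⟨(TrivSqZeroExt.fstHom K K (Q.A → K)).comp θ, fun a => by simp [hθ]⟩

variable (φ) in
/-- The element of `A` represented by a list of arrows. -/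
def wordElem (l : List Q.A) : A := (l.map fun a => φ (arrowElem K Q a)).prod

variable (φ) in
/-- The span of the words of length at least `k`. -/
def wordSpan (k : ℕ) : Submodule K A :=
  Submodule.span K {x | ∃ l : List Q.A, k ≤ l.length ∧ wordElem φ l = x}

lemma wordElem_append (l l' : List Q.A) :
    wordElem φ (l ++ l') = wordElem φ l * wordElem φ l' := by
  simp [wordElem]

lemma wordSpan_mul_le (k l : ℕ) : wordSpan φ k * wordSpan φ l ≤ wordSpan φ (k + l) := by
  rw [wordSpan, wordSpan, Submodule.span_mul_span, wordSpan, Submodule.span_le]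
  rintro _ ⟨_, ⟨u, hu, rfl⟩, _, ⟨v, hv, rfl⟩, rfl⟩
  exact Submodule.subset_span ⟨u ++ v, by rw [List.length_append]; omega, wordElem_append u v⟩

lemma adjoin_range_arrows (hadm : IsAdmissiblePresentation K Q φ) (hV : Fintype.card Q.V = 1) :
    Algebra.adjoin K (Set.range fun a => φ (arrowElem K Q a)) = ⊤ := by
  rw [← (AlgHom.range_eq_top φ).2 hadm.1, ← Algebra.map_top, ← adjoin_arrowElem hV,
    AlgHom.map_adjoin, ← Set.range_comp]
  rfl

lemma wordSpan_zero (hadm : IsAdmissiblePresentation K Q φ) (hV : Fintype.card Q.V = 1) :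
    wordSpan φ 0 = ⊤ := by
  have h1 : (1 : A) ∈ wordSpan φ 0 := Submodule.subset_span ⟨[], le_rfl, by simp [wordElem]⟩
  let B : Subalgebra K A := (wordSpan φ 0).toSubalgebra h1 fun x y hx hy =>
    wordSpan_mul_le 0 0 (Submodule.mul_mem_mul hx hy)
  have hB : B = ⊤ := by
    rw [eq_top_iff, ← adjoin_range_arrows hadm hV, Algebra.adjoin_le_iff]
    rintro _ ⟨a, rfl⟩
    exact Submodule.subset_span ⟨[a], by simp, by simp [wordElem]⟩
  rw [eq_top_iff]
  intro x _
  have : x ∈ B := by rw [hB]; trivial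
  exact this

lemma exists_wordElem_eq_zero (hadm : IsAdmissiblePresentation K Q φ)
    (hV : Fintype.card Q.V = 1) :
    ∃ m : ℕ, ∀ l : List Q.A, m ≤ l.length → wordElem φ l = 0 := by
  obtain ⟨m, hm, h⟩ := hadm.2.2
  refine ⟨m, fun l hl => ?_⟩
  have hp := h ⟨l, by rintro rfl; simp at hl; omega, List.Pairwise.isChain
    (List.pairwise_of_forall fun _ _ => Fintype.card_le_one_iff.1 hV.le _ _)⟩ hl
  rw [pathElem, map_list_prod, List.map_map] at hp
  exact hp

lemma mem_wordSpan_one (hadm : IsAdmissiblePresentation K Q φ) (hV : Fintype.card Q.V = 1)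
    {ε : A →ₐ[K] K} (hε : ∀ a, ε (φ (arrowElem K Q a)) = 0) {x : A} (hx : ε x = 0) :
    x ∈ wordSpan φ 1 := by
  have key : ∀ y ∈ wordSpan φ 0, y - algebraMap K A (ε y) ∈ wordSpan φ 1 := by
    intro y hy
    refine Submodule.span_induction (p := fun y _ => y - algebraMap K A (ε y) ∈ wordSpan φ 1)
      ?_ (by simp) (fun y z _ _ hy hz => ?_) (fun r y _ hy => ?_) hy
    · rintro _ ⟨_ | ⟨a, l⟩, -, rfl⟩
      · simp [wordElem]
      · have : ε (wordElem φ (a :: l)) = 0 := by simp [wordElem, hε]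
        rw [this, map_zero, sub_zero]
        exact Submodule.subset_span ⟨a :: l, by simp, rfl⟩
    · rw [map_add, map_add, add_sub_add_comm]
      exact add_mem hy hz
    · rw [map_smul, Algebra.algebraMap_eq_smul_one, smul_assoc, ← Algebra.algebraMap_eq_smul_one,
        ← smul_sub]
      exact Submodule.smul_mem _ _ hy
  have := key x (by rw [wordSpan_zero hadm hV]; trivial)
  rwa [hx, map_zero, sub_zero] at this

lemma isNilpotent_of_augmentation (hadm : IsAdmissiblePresentation K Q φ)
    (hV : Fintype.card Q.V = 1) {ε : A →ₐ[K] K} (hε : ∀ a, ε (φ (arrowElem K Q a)) = 0)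
    {x : A} (hx : ε x = 0) : IsNilpotent x := by
  obtain ⟨m, hm⟩ := exists_wordElem_eq_zero hadm hV
  have hpow : ∀ k, x ^ k ∈ wordSpan φ k := by
    intro k
    induction k with
    | zero => rw [wordSpan_zero hadm hV]; trivial
    | succ k ih =>
      rw [pow_succ]
      exact wordSpan_mul_le k 1 (Submodule.mul_mem_mul ih (mem_wordSpan_one hadm hV hε hx))
  refine ⟨m, ?_⟩
  have hbot : wordSpan φ m ≤ ⊥ := by
    rw [wordSpan, Submodule.span_le]
    rintro _ ⟨l, hl, rfl⟩
    exact hm l hl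
  exact hbot (hpow m)

/-- A nonzero word of maximal length spans a one-dimensional two-sided ideal. -/
lemma exists_socle_elem (hadm : IsAdmissiblePresentation K Q φ) (hV : Fintype.card Q.V = 1)
    {ε : A →ₐ[K] K} (hε : ∀ a, ε (φ (arrowElem K Q a)) = 0) :
    ∃ s : A, s ≠ 0 ∧ ∀ x, x * s = ε x • s ∧ s * x = ε x • s := by
  obtain ⟨m, hm⟩ := exists_wordElem_eq_zero hadm hV
  have : Nontrivial A := ε.toRingHom.domain_nontrivial
  let P : ℕ → Prop := fun k => ∃ l : List Q.A, l.length = k ∧ wordElem φ l ≠ 0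
  have hP0 : P 0 := ⟨[], rfl, by simp [wordElem]⟩
  classical
  obtain ⟨l, hl, hl0⟩ : P (Nat.findGreatest P m) := Nat.findGreatest_spec (Nat.zero_le m) hP0
  have hmax : ∀ l' : List Q.A, l.length < l'.length → wordElem φ l' = 0 := by
    intro l' hl'
    by_contra h0
    rcases le_or_gt l'.length m with h | h
    · exact Nat.findGreatest_is_greatest (hl ▸ hl') h ⟨l', rfl, h0⟩
    · exact h0 (hm l' h.le)
  have key : ∀ x ∈ wordSpan φ 1, x * wordElem φ l = 0 ∧ wordElem φ l * x = 0 := by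
    intro x hx
    refine Submodule.span_induction
      (p := fun x _ => x * wordElem φ l = 0 ∧ wordElem φ l * x = 0) ?_ (by simp)
      (fun y z _ _ hy hz => ?_) (fun r y _ hy => ?_) hx
    · rintro _ ⟨u, hu, rfl⟩
      rw [← wordElem_append, ← wordElem_append]
      exact ⟨hmax _ (by rw [List.length_append]; omega),
        hmax _ (by rw [List.length_append]; omega)⟩
    · rw [add_mul, mul_add, hy.1, hy.2, hz.1, hz.2, add_zero]
      exact ⟨rfl, rfl⟩
    · rw [smul_mul_assoc, mul_smul_comm, hy.1, hy.2, smul_zero]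
      exact ⟨rfl, rfl⟩
  refine ⟨wordElem φ l, hl0, fun x => ?_⟩
  have h := key (x - algebraMap K A (ε x)) (mem_wordSpan_one hadm hV hε (by simp))
  rw [sub_mul, mul_sub, sub_eq_zero, sub_eq_zero, ← Algebra.commutes, ← Algebra.smul_def] at h
  exact h

/-- If `A` is spanned by `1` and the multiples of a nilpotent element, then the quiver has at
most one arrow. -/
lemma card_arrows_le_one (hadm : IsAdmissiblePresentation K Q φ) (hV : Fintype.card Q.V = 1)
    (c : A) (hc : IsNilpotent c) (h : ∀ x : A, ∃ (r : K) (y : A), x = algebraMap K A r + c * y) :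
    Fintype.card Q.A ≤ 1 := by
  obtain ⟨θ, hθ⟩ := exists_hom_trivSqZeroExt hadm hV
  have hfst : (θ c).fst = 0 := by
    have : IsNilpotent (((TrivSqZeroExt.fstHom K K (Q.A → K)).comp θ) c) := hc.map _
    exact this.eq_zero
  have hsnd : ∀ x, ∃ r : K, r • (θ c).snd = (θ x).snd := by
    intro x
    obtain ⟨r, y, rfl⟩ := h x
    exact ⟨(θ y).fst, by simp [hfst, TrivSqZeroExt.algebraMap_eq_inl]⟩
  have hspan : ∀ v : Q.A → K, v ∈ K ∙ (θ c).snd := by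
    intro v
    rw [pi_eq_sum_univ' v]
    refine Submodule.sum_mem _ fun a _ => Submodule.smul_mem _ _ ?_
    obtain ⟨r, hr⟩ := hsnd (φ (arrowElem K Q a))
    rw [hθ, TrivSqZeroExt.snd_inr] at hr
    refine Submodule.mem_span_singleton.2 ⟨r, hr.trans ?_⟩
    ext b
    simp [Pi.single_apply, eq_comm]
  have := finrank_le_one (θ c).snd fun v => Submodule.mem_span_singleton.1 (hspan v)
  rwa [Module.finrank_fintype_fun_eq_card] at this

/-- Evaluating a fixed linear map on the matrices of finitely many elements of the path algebra
and taking the determinant is a polynomial function on the representation space. -/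
lemma exists_eval_eq_det (hV : Fintype.card Q.V = 1) (d : Q.V → ℕ)
    (T : Matrix (RepIx Q d) (RepIx Q d) K →ₗ[K] (RepIx Q d → K))
    (z : RepIx Q d → PathAlgebra K Q) :
    ∃ P : MvPolynomial (Q.A × RepIx Q d × RepIx Q d) K, ∀ M : RepSpace K Q d,
      MvPolynomial.eval (fun x => M x.1 x.2.1 x.2.2) P =
        (Matrix.of fun i j => T (liftArrows hV M (z j)) i).det := by
  let G := liftArrows (K := K) hV fun a => Matrix.of fun i j : RepIx Q d =>
    (MvPolynomial.X (a, i, j) : MvPolynomial (Q.A × RepIx Q d × RepIx Q d) K)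
  refine ⟨(Matrix.of fun i j => ∑ k, ∑ l,
    G (z j) k l * MvPolynomial.C (T (Matrix.single k l 1) i)).det, fun M => ?_⟩
  have hG : ∀ y k l, MvPolynomial.eval (fun x => M x.1 x.2.1 x.2.2) (G y k l) =
      liftArrows hV M y k l := by
    intro y k l
    have : (MvPolynomial.aeval fun x : Q.A × RepIx Q d × RepIx Q d =>
        M x.1 x.2.1 x.2.2).mapMatrix.comp G = liftArrows hV M := by
      refine pathAlgebra_hom_ext hV fun a => ?_
      ext i j
      simp [G]
    rw [← this]
    rfl
  rw [RingHom.map_det]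
  congr 1
  ext i j
  simp only [RingHom.mapMatrix_apply, Matrix.map_apply, Matrix.of_apply, map_sum, map_mul, hG,
    MvPolynomial.eval_C]
  conv_rhs => rw [Matrix.matrix_eq_sum_single (liftArrows hV M (z j))]
  simp only [map_sum, Finset.sum_apply]
  refine Finset.sum_congr rfl fun k _ => Finset.sum_congr rfl fun l _ => ?_
  have hsingle : ∀ r : K, Matrix.single k l r = r • Matrix.single k l (1 : K) := fun r => by
    rw [Matrix.smul_single, smul_eq_mul, mul_one]
  rw [hsingle (liftArrows hV M (z j) k l), map_smul, Pi.smul_apply, smul_eq_mul]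

lemma surjective_of_det_ne_zero {ι : Type} [Fintype ι] [DecidableEq ι] {W : Type}
    [AddCommGroup W] [Module K W] (L : W →ₗ[K] (ι → K)) (x : ι → W)
    (h : (Matrix.of fun i j => L (x j) i).det ≠ 0) : Function.Surjective L := by
  intro u
  set N : Matrix ι ι K := Matrix.of fun i j => L (x j) i
  refine ⟨∑ j, (N⁻¹.mulVec u) j • x j, ?_⟩
  have hN : N.mulVec (N⁻¹.mulVec u) = u := by
    rw [Matrix.mulVec_mulVec, Matrix.mul_nonsing_inv N (isUnit_iff_ne_zero.2 h), Matrix.one_mulVec]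
  rw [map_sum]
  conv_rhs => rw [← hN]
  ext i
  simp [Matrix.mulVec, dotProduct, N, mul_comm]

lemma isOpen_eval_ne_zero (d : Q.V → ℕ) (P : MvPolynomial (Q.A × RepIx Q d × RepIx Q d) K) :
    @IsOpen _ (repTopology K Q d)
      {M | MvPolynomial.eval (fun x : Q.A × RepIx Q d × RepIx Q d => M x.1 x.2.1 x.2.2) P ≠ 0} :=
  ⟨_, TopologicalSpace.GenerateOpen.basic _ ⟨P, rfl⟩, rfl⟩

/-- A linear condition of maximal rank on the action of `A` is open, so two such conditions which
are satisfiable separately are satisfiable simultaneously on an irreducible variety. -/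
lemma exists_hom_surjective_surjective (hadm : IsAdmissiblePresentation K Q φ)
    (hV : Fintype.card Q.V = 1) (d : Q.V → ℕ)
    (hirr : @IsIrreducible _ (repTopology K Q d) (RepSet K Q φ d))
    (T₀ T₁ : Matrix (RepIx Q d) (RepIx Q d) K →ₗ[K] (RepIx Q d → K))
    (ρ₀ ρ₁ : A →ₐ[K] Matrix (RepIx Q d) (RepIx Q d) K)
    (h₀ : Function.Surjective (T₀ ∘ ρ₀)) (h₁ : Function.Surjective (T₁ ∘ ρ₁)) :
    ∃ ρ : A →ₐ[K] Matrix (RepIx Q d) (RepIx Q d) K,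
      Function.Surjective (T₀ ∘ ρ) ∧ Function.Surjective (T₁ ∘ ρ) := by
  have key : ∀ (T : Matrix (RepIx Q d) (RepIx Q d) K →ₗ[K] (RepIx Q d → K))
      (ρ : A →ₐ[K] Matrix (RepIx Q d) (RepIx Q d) K), Function.Surjective (T ∘ ρ) →
      ∃ P : MvPolynomial (Q.A × RepIx Q d × RepIx Q d) K,
        (RepSet K Q φ d ∩ {M | MvPolynomial.eval
          (fun x : Q.A × RepIx Q d × RepIx Q d => M x.1 x.2.1 x.2.2) P ≠ 0}).Nonempty ∧
        ∀ ρ' : A →ₐ[K] Matrix (RepIx Q d) (RepIx Q d) K,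
          MvPolynomial.eval (fun x : Q.A × RepIx Q d × RepIx Q d =>
            ρ' (φ (arrowElem K Q x.1)) x.2.1 x.2.2) P ≠ 0 → Function.Surjective (T ∘ ρ') := by
    intro T ρ hρ
    choose y hy using fun j : RepIx Q d => hρ (Pi.single j 1)
    choose z hz using fun j => hadm.1 (y j)
    obtain ⟨P, hP⟩ := exists_eval_eq_det hV d T z
    have hlift : ∀ ρ' : A →ₐ[K] Matrix (RepIx Q d) (RepIx Q d) K,
        liftArrows hV (fun a => ρ' (φ (arrowElem K Q a))) = ρ'.comp φ := fun ρ' =>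
      pathAlgebra_hom_ext hV fun a => by simp
    refine ⟨P, ⟨fun a => ρ (φ (arrowElem K Q a)), (mem_repSet_iff hadm hV d _).2 ⟨ρ, fun _ => rfl⟩,
      ?_⟩, fun ρ' hρ' => ?_⟩
    · have hdet := hP fun a => ρ (φ (arrowElem K Q a))
      rw [hlift] at hdet
      have : (Matrix.of fun i j => T ((ρ.comp φ) (z j)) i) = (1 : Matrix _ _ K) := by
        ext i j
        rw [Matrix.of_apply, AlgHom.comp_apply, hz]
        have := congrFun (hy j) i
        rw [Function.comp_apply] at this
        rw [this, Pi.single_apply, Matrix.one_apply]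
      rw [this, Matrix.det_one] at hdet
      exact hdet.trans_ne one_ne_zero
    · rw [hP (fun a => ρ' (φ (arrowElem K Q a))), hlift] at hρ'
      exact surjective_of_det_ne_zero (T ∘ₗ ρ'.toLinearMap) (fun j => φ (z j)) hρ'
  obtain ⟨P₀, hP₀, hs₀⟩ := key T₀ ρ₀ h₀
  obtain ⟨P₁, hP₁, hs₁⟩ := key T₁ ρ₁ h₁
  obtain ⟨M, hM, hM₀, hM₁⟩ := hirr.2 _ _ (isOpen_eval_ne_zero d P₀) (isOpen_eval_ne_zero d P₁)
    hP₀ hP₁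
  obtain ⟨ρ, hρ⟩ := (mem_repSet_iff hadm hV d M).1 hM
  obtain rfl : M = fun a => ρ (φ (arrowElem K Q a)) := funext hρ
  exact ⟨ρ, hs₀ ρ hM₀, hs₁ ρ hM₁⟩

/-- If `A` is geometrically irreducible, every quotient algebra `B` yields a linear form on `A`
whose associated bilinear form has rank `dim B`. -/
lemma exists_dual_finrank_ker [Module.Finite K A] (hadm : IsAdmissiblePresentation K Q φ)
    (hV : Fintype.card Q.V = 1) (hirr : IsGeomIrreducible K Q φ)
    {B : Type} [Ring B] [Algebra K B] [Module.Finite K B] (ψ : A →ₐ[K] B)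
    (hψ : Function.Surjective ψ) :
    ∃ l : Module.Dual K A, Module.finrank K (LinearMap.ker ((LinearMap.mul K A).compr₂ l)) +
      Module.finrank K B = Module.finrank K A := by
  let d : Q.V → ℕ := fun _ => Module.finrank K B
  have hcard : Fintype.card (RepIx Q d) = Module.finrank K B := by
    simp [d, hV]
  let b : Module.Basis (RepIx Q d) K B := (Module.finBasis K B).reindex
    (Fintype.equivOfCardEq (by rw [hcard, Fintype.card_fin]))
  let T₀ : Matrix (RepIx Q d) (RepIx Q d) K →ₗ[K] (RepIx Q d → K) :=
    { toFun := fun X => X.mulVec (b.repr 1)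
      map_add' := fun X Y => Matrix.add_mulVec X Y _
      map_smul' := fun r X => Matrix.smul_mulVec r X _ }
  let T₁ : Matrix (RepIx Q d) (RepIx Q d) K →ₗ[K] (RepIx Q d → K) :=
    { toFun := fun X => Matrix.vecMul (b.repr 1) X
      map_add' := fun X Y => Matrix.vecMul_add X Y _
      map_smul' := fun r X => Matrix.vecMul_smul _ r X }
  let τ : B →ₐ[K] Matrix (RepIx Q d) (RepIx Q d) K := AlgHom.ofLinearMap
    { toFun := fun x => (LinearMap.toMatrix b b (LinearMap.mulRight K x)).transpose
      map_add' := fun x y => by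
        rw [← Matrix.transpose_add, ← map_add]
        congr 2
        ext z
        simp [mul_add]
      map_smul' := fun r x => by
        rw [RingHom.id_apply, ← Matrix.transpose_smul, ← map_smul]
        congr 2
        ext z
        simp }
    (by simp) (fun x y => by
      change (LinearMap.toMatrix b b (LinearMap.mulRight K (x * y))).transpose = _
      rw [LinearMap.mulRight_mul, LinearMap.toMatrix_comp b b b, Matrix.transpose_mul]
      rfl)
  have hsurj : Function.Surjective fun a => (b.repr (ψ a) : RepIx Q d → K) := fun u => by
    obtain ⟨a, ha⟩ := hψ (b.equivFun.symm u)
    exact ⟨a, by beta_reduce; rw [ha, ← b.equivFun_apply, LinearEquiv.apply_symm_apply]⟩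
  have h₀ : Function.Surjective (T₀ ∘ (Algebra.leftMulMatrix b).comp ψ) := by
    convert hsurj using 2 with a
    change (Algebra.leftMulMatrix b (ψ a)).mulVec (b.repr 1) = _
    rw [Algebra.leftMulMatrix_mulVec_repr, mul_one]
  have h₁ : Function.Surjective (T₁ ∘ τ.comp ψ) := by
    convert hsurj using 2 with a
    change Matrix.vecMul (b.repr 1) (LinearMap.toMatrix b b (LinearMap.mulRight K (ψ a))).transpose
      = _
    rw [Matrix.vecMul_transpose, LinearMap.toMatrix_mulVec_repr, LinearMap.mulRight_apply, one_mul]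
  obtain ⟨ρ, hρ₀, hρ₁⟩ := exists_hom_surjective_surjective hadm hV d (hirr d) T₀ T₁ _ _ h₀ h₁
  let l : Module.Dual K A :=
    { toFun := fun a => dotProduct (b.repr 1) (T₀ (ρ a))
      map_add' := fun x y => by rw [map_add, map_add, dotProduct_add]
      map_smul' := fun r x => by rw [map_smul, map_smul, dotProduct_smul]; rfl }
  refine ⟨l, ?_⟩
  have hl : ∀ x y, l (x * y) = dotProduct (T₁ (ρ x)) (T₀ (ρ y)) := by
    intro x y
    change dotProduct (b.repr 1) ((ρ (x * y)).mulVec (b.repr 1)) =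
      dotProduct (Matrix.vecMul (b.repr 1) (ρ x)) ((ρ y).mulVec (b.repr 1))
    rw [map_mul, ← Matrix.mulVec_mulVec, Matrix.dotProduct_mulVec]
  have hker : LinearMap.ker ((LinearMap.mul K A).compr₂ l) =
      LinearMap.ker (T₁ ∘ₗ ρ.toLinearMap) := by
    ext x
    rw [LinearMap.mem_ker, LinearMap.mem_ker]
    constructor
    · intro hx
      refine dotProduct_eq_zero _ fun u => ?_
      obtain ⟨y, rfl⟩ := hρ₀ u
      exact (hl x y).symm.trans (LinearMap.congr_fun hx y)
    · intro hx
      ext y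
      refine (hl x y).trans ?_
      have hx' : T₁ (ρ x) = 0 := hx
      rw [hx', zero_dotProduct]
      rfl
  have hrank := LinearMap.finrank_range_add_finrank_ker (T₁ ∘ₗ ρ.toLinearMap)
  rw [LinearMap.range_eq_top.2 hρ₁, finrank_top, Module.finrank_fintype_fun_eq_card, hcard] at hrank
  rw [hker, add_comm, hrank]

lemma card_arrows_le_one_of_isGeomIrreducible [Module.Finite K A]
    (hadm : IsAdmissiblePresentation K Q φ) (hV : Fintype.card Q.V = 1)
    (hirr : IsGeomIrreducible K Q φ) : Fintype.card Q.A ≤ 1 := by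
  obtain ⟨ε, hε⟩ := exists_augmentation hadm hV
  obtain ⟨s, hs0, hs⟩ := exists_socle_elem hadm hV hε
  let I : Ideal A :=
    { carrier := (K ∙ s : Submodule K A)
      add_mem' := fun hx hy => add_mem hx hy
      zero_mem' := Submodule.zero_mem _
      smul_mem' := fun x y hy => by
        obtain ⟨r, rfl⟩ := Submodule.mem_span_singleton.1 hy
        rw [smul_eq_mul, mul_smul_comm, (hs x).1]
        exact Submodule.smul_mem _ _
          (Submodule.smul_mem _ _ (Submodule.mem_span_singleton_self s)) }
  have hI : I.IsTwoSided := ⟨fun {y} x hy => by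
    obtain ⟨r, rfl⟩ := Submodule.mem_span_singleton.1 hy
    rw [smul_mul_assoc, (hs x).2]
    exact Submodule.smul_mem _ _ (Submodule.smul_mem _ _ (Submodule.mem_span_singleton_self s))⟩
  let π := Ideal.Quotient.mkₐ K I
  have hπ : Function.Surjective π := Ideal.Quotient.mkₐ_surjective K I
  have hfin : Module.Finite K (A ⧸ I) := Module.Finite.of_surjective π.toLinearMap hπ
  have hdim : Module.finrank K (A ⧸ I) + 1 = Module.finrank K A := by
    have h := LinearMap.finrank_range_add_finrank_ker π.toLinearMap
    have hk : LinearMap.ker π.toLinearMap = K ∙ s := by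
      ext x
      exact Ideal.Quotient.eq_zero_iff_mem
    rwa [LinearMap.range_eq_top.2 hπ, finrank_top, hk, finrank_span_singleton hs0] at h
  obtain ⟨l, hl⟩ := exists_dual_finrank_ker hadm hV hirr (AlgHom.id K A) Function.surjective_id
  obtain ⟨μ, hμ⟩ := exists_dual_finrank_ker hadm hV hirr π hπ
  have hinj : Function.Injective ((LinearMap.mul K A).compr₂ l) := by
    rw [← LinearMap.ker_eq_bot, ← Submodule.finrank_eq_zero (R := K)]
    omega
  obtain ⟨c, hc⟩ := (LinearMap.injective_iff_surjective_of_finrank_eq_finrank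
    (Subspace.dual_finrank_eq (K := K) (V := A)).symm).1 hinj μ
  have hker : LinearMap.ker ((LinearMap.mul K A).compr₂ μ) =
      LinearMap.ker (LinearMap.mulLeft K c) := by
    ext x
    rw [LinearMap.mem_ker, LinearMap.mem_ker, LinearMap.mulLeft_apply,
      ← map_eq_zero_iff _ hinj, ← hc]
    simp only [LinearMap.ext_iff, LinearMap.compr₂_apply, LinearMap.mul_apply', mul_assoc]
  rw [hker] at hμ
  have hεc : ε c = 0 := by
    by_contra h0
    have hnil := isNilpotent_of_augmentation hadm hV hε (x := c - algebraMap K A (ε c)) (by simp)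
    have hunit : IsUnit c := by
      have := hnil.isUnit_add_right_of_commute ((isUnit_iff_ne_zero.2 h0).map (algebraMap K A))
        (Algebra.commutes (ε c) _).symm
      rwa [sub_add_cancel] at this
    have : LinearMap.ker (LinearMap.mulLeft K c) = ⊥ :=
      LinearMap.ker_eq_bot.2 fun x y hxy => hunit.mul_left_cancel hxy
    rw [this, finrank_bot] at hμ
    omega
  refine card_arrows_le_one hadm hV c (isNilpotent_of_augmentation hadm hV hε hεc) fun x => ?_
  have hrange : LinearMap.range (LinearMap.mulLeft K c) = LinearMap.ker ε.toLinearMap := by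
    refine Submodule.eq_of_le_of_finrank_eq ?_ ?_
    · rintro _ ⟨y, rfl⟩
      simp [hεc]
    · have h1 := LinearMap.finrank_range_add_finrank_ker (LinearMap.mulLeft K c)
      have h2 := LinearMap.finrank_range_add_finrank_ker ε.toLinearMap
      have hsurj : Function.Surjective ε.toLinearMap := fun r => ⟨algebraMap K A r, by simp⟩
      rw [LinearMap.range_eq_top.2 hsurj, finrank_top, Module.finrank_self] at h2
      omega
  have hx : x - algebraMap K A (ε x) ∈ LinearMap.range (LinearMap.mulLeft K c) := by
    rw [hrange]
    simp
  obtain ⟨y, hy⟩ := hx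
  exact ⟨ε x, y, by rw [← LinearMap.mulLeft_apply (R := K), hy, add_sub_cancel]⟩

lemma card_arrows_le_one_of_algEquiv (hadm : IsAdmissiblePresentation K Q φ)
    (hV : Fintype.card Q.V = 1) (m : ℕ)
    (e : A ≃ₐ[K] (Polynomial K ⧸ Ideal.span {(Polynomial.X : Polynomial K) ^ m})) :
    Fintype.card Q.A ≤ 1 := by
  let π := Ideal.Quotient.mk (Ideal.span {(Polynomial.X : Polynomial K) ^ m})
  refine card_arrows_le_one hadm hV (e.symm (π Polynomial.X)) ⟨m, ?_⟩ fun x => ?_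
  · rw [← map_pow, ← map_pow, Ideal.Quotient.eq_zero_iff_mem.2 (Ideal.mem_span_singleton_self _),
      map_zero]
  · obtain ⟨p, hp⟩ := Ideal.Quotient.mk_surjective (e x)
    refine ⟨p.coeff 0, e.symm (π p.divX), e.injective ?_⟩
    rw [← hp, map_add, map_mul, AlgEquiv.commutes, AlgEquiv.apply_symm_apply,
      AlgEquiv.apply_symm_apply, ← map_mul, add_comm]
    conv_lhs => rw [← p.X_mul_divX_add]
    rw [map_add]
    rfl

lemma exists_generator (hadm : IsAdmissiblePresentation K Q φ) (hV : Fintype.card Q.V = 1)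
    (hA : Fintype.card Q.A ≤ 1) :
    ∃ (x : A) (m : ℕ), x ^ m = 0 ∧ (∀ a, φ (arrowElem K Q a) = x) ∧
      Function.Surjective (Polynomial.aeval (R := K) x) := by
  obtain ⟨ε, hε⟩ := exists_augmentation hadm hV
  obtain ⟨x, hx0, hx⟩ : ∃ x : A, ε x = 0 ∧ ∀ a, φ (arrowElem K Q a) = x := by
    rcases isEmpty_or_nonempty Q.A with h | ⟨⟨a⟩⟩
    · exact ⟨0, map_zero _, fun a => h.elim a⟩
    · exact ⟨φ (arrowElem K Q a), hε a, fun b => by rw [Fintype.card_le_one_iff.1 hA a b]⟩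
  obtain ⟨m, hm⟩ := isNilpotent_of_augmentation hadm hV hε hx0
  refine ⟨x, m, hm, hx, ?_⟩
  rw [← AlgHom.range_eq_top, eq_top_iff, ← adjoin_range_arrows hadm hV, Algebra.adjoin_le_iff]
  rintro _ ⟨a, rfl⟩
  exact ⟨Polynomial.X, by simp [hx]⟩

/-- A local algebra whose quiver has at most one arrow is a truncated polynomial ring generated by
the image of that arrow. -/
lemma exists_algEquiv (hadm : IsAdmissiblePresentation K Q φ) (hV : Fintype.card Q.V = 1)
    (hA : Fintype.card Q.A ≤ 1) :
    ∃ (m : ℕ) (e : (Polynomial K ⧸ Ideal.span {(Polynomial.X : Polynomial K) ^ (m + 1)}) ≃ₐ[K] A),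
      ∀ a, φ (arrowElem K Q a) = e (Ideal.Quotient.mk _ Polynomial.X) := by
  obtain ⟨x, n, hn, hx, hsurj⟩ := exists_generator hadm hV hA
  obtain ⟨ε, -⟩ := exists_augmentation hadm hV
  have : Nontrivial A := ε.toRingHom.domain_nontrivial
  obtain ⟨p, hp⟩ : ∃ p, RingHom.ker (Polynomial.aeval (R := K) x) = Ideal.span {p} :=
    ⟨_, (Ideal.span_singleton_generator _).symm⟩
  have hdvd : p ∣ Polynomial.X ^ n := by
    rw [← Ideal.mem_span_singleton, ← hp, RingHom.mem_ker]
    simp [hn]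
  obtain ⟨k, -, hk⟩ := (dvd_prime_pow Polynomial.prime_X n).1 hdvd
  rw [Ideal.span_singleton_eq_span_singleton.2 hk] at hp
  obtain ⟨m, rfl⟩ : ∃ m, k = m + 1 := by
    refine Nat.exists_eq_succ_of_ne_zero ?_
    rintro rfl
    rw [pow_zero, Ideal.span_singleton_one] at hp
    exact RingHom.ker_ne_top _ hp
  let e := (Ideal.quotientEquivAlgOfEq K hp.symm).trans
    (Ideal.quotientKerAlgEquivOfSurjective hsurj)
  refine ⟨m, e, fun a => ?_⟩
  rw [hx]
  simp [e]

lemma exists_eval_ne_zero_of_isOpen (d : Q.V → ℕ) {U : Set (RepSpace K Q d)}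
    (hU : @IsOpen _ (repTopology K Q d) U) {M : RepSpace K Q d} (hM : M ∈ U) :
    ∃ f : MvPolynomial (Q.A × RepIx Q d × RepIx Q d) K,
      MvPolynomial.eval (fun x => M x.1 x.2.1 x.2.2) f ≠ 0 ∧
      ∀ N : RepSpace K Q d, MvPolynomial.eval (fun x => N x.1 x.2.1 x.2.2) f ≠ 0 → N ∈ U := by
  obtain ⟨V, hV, rfl⟩ := hU
  suffices h : ∀ x ∈ V, ∃ f : MvPolynomial (Q.A × RepIx Q d × RepIx Q d) K,
      MvPolynomial.eval x f ≠ 0 ∧ ∀ y, MvPolynomial.eval y f ≠ 0 → y ∈ V by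
    obtain ⟨f, hf, hfV⟩ := h _ hM
    exact ⟨f, hf, fun N => hfV _⟩
  clear hM
  induction (hV : TopologicalSpace.GenerateOpen _ V) with
  | basic V hV =>
    obtain ⟨f, rfl⟩ := hV
    exact fun x hx => ⟨f, hx, fun y hy => hy⟩
  | univ => exact fun x _ => ⟨1, by simp, fun y _ => Set.mem_univ y⟩
  | inter V W _ _ ihV ihW =>
    intro x hx
    obtain ⟨f, hf, hfV⟩ := ihV x hx.1
    obtain ⟨g, hg, hgW⟩ := ihW x hx.2
    refine ⟨f * g, by simp [hf, hg], fun y hy => ?_⟩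
    rw [map_mul] at hy
    exact ⟨hfV y (left_ne_zero_of_mul hy), hgW y (right_ne_zero_of_mul hy)⟩
  | sUnion S _ ih =>
    rintro x ⟨V, hVS, hx⟩
    obtain ⟨f, hf, hfV⟩ := ih V hVS x hx
    exact ⟨f, hf, fun y hy => ⟨V, hVS, hfV y hy⟩⟩

/-- The image of an affine space under a polynomial map is irreducible. -/
lemma isIrreducible_range_eval [Infinite K] (d : Q.V → ℕ) {τ : Type}
    (p : Q.A → Matrix (RepIx Q d) (RepIx Q d) (MvPolynomial τ K)) :
    @IsIrreducible _ (repTopology K Q d)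
      (Set.range fun (s : τ → K) a => (p a).map (MvPolynomial.eval s)) := by
  refine ⟨Set.range_nonempty _, ?_⟩
  have key : ∀ (s : τ → K) (f : MvPolynomial (Q.A × RepIx Q d × RepIx Q d) K),
      MvPolynomial.eval s (MvPolynomial.bind₁ (fun x => p x.1 x.2.1 x.2.2) f) =
        MvPolynomial.eval (fun x => (p x.1).map (MvPolynomial.eval s) x.2.1 x.2.2) f := by
    intro s f
    exact MvPolynomial.eval₂Hom_bind₁ _ _ _ f
  rintro U W hU hW ⟨_, ⟨s, rfl⟩, hsU⟩ ⟨_, ⟨t, rfl⟩, htW⟩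
  obtain ⟨f, hf, hfU⟩ := exists_eval_ne_zero_of_isOpen d hU hsU
  obtain ⟨g, hg, hgW⟩ := exists_eval_ne_zero_of_isOpen d hW htW
  have hF : MvPolynomial.bind₁ (fun x => p x.1 x.2.1 x.2.2) f ≠ 0 := by
    intro h
    apply hf
    rw [← key, h, map_zero]
  have hG : MvPolynomial.bind₁ (fun x => p x.1 x.2.1 x.2.2) g ≠ 0 := by
    intro h
    apply hg
    rw [← key, h, map_zero]
  obtain ⟨r, hr⟩ : ∃ r, MvPolynomial.eval r (MvPolynomial.bind₁ (fun x => p x.1 x.2.1 x.2.2) f *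
      MvPolynomial.bind₁ (fun x => p x.1 x.2.1 x.2.2) g) ≠ 0 := by
    by_contra! h
    exact mul_ne_zero hF hG (MvPolynomial.funext fun r => by rw [h, map_zero])
  rw [map_mul, key, key] at hr
  exact ⟨_, ⟨r, rfl⟩, hfU _ (left_ne_zero_of_mul hr), hgW _ (right_ne_zero_of_mul hr)⟩

lemma repSet_eq_of_card_le_one (hadm : IsAdmissiblePresentation K Q φ)
    (hV : Fintype.card Q.V = 1) (hA : Fintype.card Q.A ≤ 1) (d : Q.V → ℕ) :
    ∃ m : ℕ, RepSet K Q φ d = {M | ∃ X, X ^ (m + 1) = 0 ∧ M = fun _ => X} := by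
  obtain ⟨m, e, he⟩ := exists_algEquiv hadm hV hA
  refine ⟨m, Set.ext fun M => (mem_repSet_iff hadm hV d M).trans ⟨?_, ?_⟩⟩
  · rintro ⟨ρ, hρ⟩
    refine ⟨ρ (e (Ideal.Quotient.mk _ Polynomial.X)), ?_, funext fun a => by rw [hρ, he]⟩
    rw [← map_pow, ← map_pow, ← map_pow,
      Ideal.Quotient.eq_zero_iff_mem.2 (Ideal.mem_span_singleton_self _), map_zero, map_zero]
  · rintro ⟨X, hX, rfl⟩
    let σ := Ideal.Quotient.liftₐ (Ideal.span {(Polynomial.X : Polynomial K) ^ (m + 1)})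
      (Polynomial.aeval X) fun p hp => by
        obtain ⟨q, rfl⟩ := Ideal.mem_span_singleton'.1 hp
        simp [hX]
    refine ⟨σ.comp e.symm, fun a => ?_⟩
    rw [he]
    exact ((congrArg σ (e.symm_apply_apply _)).trans (Polynomial.aeval_X X)).symm

lemma isGeomIrreducible_of_card_le_one [Infinite K] (hadm : IsAdmissiblePresentation K Q φ)
    (hV : Fintype.card Q.V = 1) (hA : Fintype.card Q.A ≤ 1) : IsGeomIrreducible K Q φ := by
  intro d
  obtain ⟨m, hm⟩ := repSet_eq_of_card_le_one hadm hV hA d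
  obtain ⟨h, hhm, hh⟩ := exists_height_conj K (RepIx Q d) m
  let ι := RepIx Q d
  let g : Matrix ι ι (MvPolynomial ((ι × ι) ⊕ (ι × ι)) K) :=
    Matrix.of fun i j => MvPolynomial.X (Sum.inl (i, j))
  let t : Matrix ι ι (MvPolynomial ((ι × ι) ⊕ (ι × ι)) K) :=
    Matrix.of fun i j => if h i < h j then MvPolynomial.X (Sum.inr (i, j)) else 0
  convert isIrreducible_range_eval d fun _ : Q.A => g * t * g.adjugate
  have heval : ∀ s : (ι × ι) ⊕ (ι × ι) → K, (g * t * g.adjugate).map (MvPolynomial.eval s) =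
      g.map (MvPolynomial.eval s) * t.map (MvPolynomial.eval s) *
        (g.map (MvPolynomial.eval s)).adjugate := by
    intro s
    rw [Matrix.map_mul, Matrix.map_mul]
    congr 1
    exact RingHom.map_adjugate _ _
  rw [hm]
  ext M
  constructor
  · rintro ⟨X, hX, rfl⟩
    obtain ⟨g', t', ht', rfl⟩ := hh X hX
    refine ⟨Sum.elim (fun x => g' x.1 x.2) fun x => t' x.1 x.2, funext fun _ => ?_⟩
    beta_reduce
    rw [heval]
    congr
    · ext i j
      simp [g]
    · ext i j
      by_cases hij : h i < h j
      · simp [t, hij]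
      · simp [t, hij, not_ne_iff.1 (mt (ht' i j) hij)]
    · ext i j
      simp [g]
  · rintro ⟨s, rfl⟩
    refine ⟨_, ?_, rfl⟩
    rw [heval]
    refine conj_adjugate_pow_eq_zero _ _ m (pow_eq_zero_of_height h m hhm _ fun i j hij => ?_)
    by_contra hlt
    simp [t, hlt] at hij

end OneVertex

/-- Let `A = KQ/I` where `Q` is a finite quiver with exactly one vertex
and `I` is an admissible ideal of `KQ`.  Then the following are equivalent:
(i) `A` is geometrically irreducible; (ii) `Q` has at most one arrow; (iii) `A` is
isomorphic as a `K`-algebra to `K[X]/(X^m)` for some `m ≥ 1`. -/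
theorem geomIrreducible_tfae_of_local [IsAlgClosed K]
    (A : Type) [Ring A] [Algebra K A] [Module.Finite K A]
    (φ : PathAlgebra K Q →ₐ[K] A) (hadm : IsAdmissiblePresentation K Q φ)
    (hlocal : Fintype.card Q.V = 1) :
    (IsGeomIrreducible K Q φ ↔ Fintype.card Q.A ≤ 1) ∧
    (IsGeomIrreducible K Q φ ↔
      ∃ m : ℕ, 1 ≤ m ∧
        Nonempty (A ≃ₐ[K] (Polynomial K ⧸ Ideal.span {(Polynomial.X : Polynomial K) ^ m}))) := by
  have hG : Fintype.card Q.A ≤ 1 → IsGeomIrreducible K Q φ :=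
    isGeomIrreducible_of_card_le_one hadm hlocal
  have hle : IsGeomIrreducible K Q φ → Fintype.card Q.A ≤ 1 :=
    card_arrows_le_one_of_isGeomIrreducible hadm hlocal
  refine ⟨⟨hle, hG⟩, fun h => ?_, ?_⟩
  · obtain ⟨m, e, -⟩ := exists_algEquiv hadm hlocal (hle h)
    exact ⟨m + 1, by omega, ⟨e.symm⟩⟩
  · rintro ⟨m, -, ⟨e⟩⟩
    exact hG (card_arrows_le_one_of_algEquiv hadm hlocal m e)
end
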